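/- Let d ≥ 2 and n ≥ 1, let μ be a partition of n into at most d parts with μ₂ ≥ 1, let p ∈ [0,1], and set p*(μ) := 1/(1 + binom(n,μ)). Define the permutation-twirled state ρ̃_≠^μ := (1/n!) Σ_{π ∈ S_n} ψ(π) ρ_≠^μ ψ(π)^{−1}. Then the supremum, over all Hermitian Π with 0 ⪯ Π ⪯ I, of p·Tr[Π ρ_=^n] + (1−p)·(1 − Tr[Π ρ̃_≠^μ]) equals 1 − (1−p)/binom(n,μ) when p ≥ p*(μ) and 1 − p when p ≤ p*(μ), attained at Π = Π_{(n)} and Π = 0 respectively; i.e., randomly permuting the inputs does not change the optimal success probability. -/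

import Mathlib

open MeasureTheory Matrix
open scoped ComplexOrder

noncomputable section

/-- The unitary group `U(d)`. -/
abbrev UG (d : ℕ) := Matrix.unitaryGroup (Fin d) ℂ

noncomputable instance (d : ℕ) : MeasurableSpace (UG d) := borel _

instance (d : ℕ) : BorelSpace (UG d) := ⟨rfl⟩

/-- The permutation matrix `ψ(π)` on `(ℂ^d)^{⊗n}`, with `(x,y)` entry `1` iff `y = x ∘ π`. -/
def psi (d n : ℕ) (π : Equiv.Perm (Fin n)) : Matrix (Fin n → Fin d) (Fin n → Fin d) ℂ :=
  Matrix.of fun x y => if y = x ∘ π then 1 else 0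

/-- The symmetrizer `Π_{(n)} = (1/n!) ∑_{π ∈ S_n} ψ(π)`. -/
def symmetrizer (d n : ℕ) : Matrix (Fin n → Fin d) (Fin n → Fin d) ℂ :=
  ((n.factorial : ℂ))⁻¹ • ∑ π : Equiv.Perm (Fin n), psi d n π

/-- The `n`-fold tensor power of a `d × d` matrix: `(U^{⊗n})_{x,y} = ∏ i, U_{x i, y i}`. -/
def tpow (d n : ℕ) (U : Matrix (Fin d) (Fin d) ℂ) :
    Matrix (Fin n → Fin d) (Fin n → Fin d) ℂ :=
  Matrix.of fun x y => ∏ i, U (x i) (y i)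

/-- The list consisting of `μ 0` copies of `0`, then `μ 1` copies of `1`, etc. -/
def wordList (d : ℕ) (μ : Fin d → ℕ) : List (Fin d) :=
  (List.ofFn fun i => List.replicate (μ i) i).flatten

lemma wordList_length (d : ℕ) (μ : Fin d → ℕ) : (wordList d μ).length = ∑ i, μ i := by
  simp [wordList, List.length_flatten, Function.comp, List.sum_ofFn]

/-- The word indexing the basis vector `|e_μ⟩`: the first `μ 0` tensor factors carry the
first basis label, the next `μ 1` factors the second basis label, etc. -/
def word (d n : ℕ) (μ : Fin d → ℕ) (hsum : ∑ i, μ i = n) (j : Fin n) : Fin d :=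
  (wordList d μ).get ⟨j, by rw [wordList_length, hsum]; exact j.isLt⟩

/-- `∫ U^{⊗n} |e_w⟩⟨e_w| (U^{⊗n})^† dq` for a basis word `w` (entrywise Bochner integral). -/
def rhoWord (d n : ℕ) (w : Fin n → Fin d) (q : Measure (UG d)) :
    Matrix (Fin n → Fin d) (Fin n → Fin d) ℂ :=
  Matrix.of fun x y =>
    ∫ U : UG d, tpow d n (U : Matrix (Fin d) (Fin d) ℂ) x w *
      star (tpow d n (U : Matrix (Fin d) (Fin d) ℂ) y w) ∂q

/-- The Haar-twirled unequal state `ρ_≠^μ`. -/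
def rhoNE (d n : ℕ) (μ : Fin d → ℕ) (hsum : ∑ i, μ i = n) (haar : Measure (UG d)) :
    Matrix (Fin n → Fin d) (Fin n → Fin d) ℂ :=
  rhoWord d n (word d n μ hsum) haar

/-- The partition `(n, 0, …, 0)`. -/
def muEq (d n : ℕ) (hd : 0 < d) : Fin d → ℕ := fun i => if i = ⟨0, hd⟩ then n else 0

lemma muEq_sum (d n : ℕ) (hd : 0 < d) : ∑ i, muEq d n hd i = n := by
  simp [muEq]

/-- The equal state `ρ_=^n = ρ_≠^{(n,0,…,0)}`. -/
def rhoEQ (d n : ℕ) (hd : 0 < d) (haar : Measure (UG d)) :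
    Matrix (Fin n → Fin d) (Fin n → Fin d) ℂ :=
  rhoNE d n (muEq d n hd) (muEq_sum d n hd) haar

/-- The set of POVM elements: Hermitian `P` with `0 ⪯ P ⪯ I`. -/
def POVMs (d n : ℕ) : Set (Matrix (Fin n → Fin d) (Fin n → Fin d) ℂ) :=
  {P | P.PosSemidef ∧ (1 - P).PosSemidef}

/-- The average success probability of the test `{P, I - P}` with prior `p` on the equal case. -/
def successProb (d n : ℕ) (hd : 0 < d) (μ : Fin d → ℕ) (hsum : ∑ i, μ i = n)
    (haar : Measure (UG d)) (p : ℝ) (P : Matrix (Fin n → Fin d) (Fin n → Fin d) ℂ) : ℝ :=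
  p * (Matrix.trace (P * rhoEQ d n hd haar)).re +
    (1 - p) * (1 - (Matrix.trace (P * rhoNE d n μ hsum haar)).re)

/-- The permutation-twirled unequal state `ρ̃_≠^μ = (1/n!) ∑_π ψ(π) ρ_≠^μ ψ(π)⁻¹`. -/
def rhoTwirl (d n : ℕ) (μ : Fin d → ℕ) (hsum : ∑ i, μ i = n) (haar : Measure (UG d)) :
    Matrix (Fin n → Fin d) (Fin n → Fin d) ℂ :=
  ((n.factorial : ℂ))⁻¹ •
    ∑ π : Equiv.Perm (Fin n), psi d n π * rhoNE d n μ hsum haar * psi d n π⁻¹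

/-- The average success probability on the randomly permuted input. -/
def successProbTwirl (d n : ℕ) (hd : 0 < d) (μ : Fin d → ℕ) (hsum : ∑ i, μ i = n)
    (haar : Measure (UG d)) (p : ℝ) (P : Matrix (Fin n → Fin d) (Fin n → Fin d) ℂ) : ℝ :=
  p * (Matrix.trace (P * rhoEQ d n hd haar)).re +
    (1 - p) * (1 - (Matrix.trace (P * rhoTwirl d n μ hsum haar)).re)

section helpers

lemma psi_mul_apply (d n : ℕ) (π : Equiv.Perm (Fin n))
    (A : Matrix (Fin n → Fin d) (Fin n → Fin d) ℂ) (x y : Fin n → Fin d) :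
    (psi d n π * A) x y = A (x ∘ π) y := by
  simp [Matrix.mul_apply, psi]

lemma mul_psi_apply (d n : ℕ) (π : Equiv.Perm (Fin n))
    (A : Matrix (Fin n → Fin d) (Fin n → Fin d) ℂ) (x y : Fin n → Fin d) :
    (A * psi d n π) x (y ∘ π) = A x y := by
  have h : ∀ z : Fin n → Fin d, (y ∘ π = z ∘ π) ↔ y = z := fun z =>
    (π.surjective.injective_comp_right).eq_iff
  simp [Matrix.mul_apply, psi, h]

lemma psi_mul_psi (d n : ℕ) (π σ : Equiv.Perm (Fin n)) :
    psi d n π * psi d n σ = psi d n (π * σ) := by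
  ext x y
  rw [psi_mul_apply]
  simp only [psi, Matrix.of_apply, Equiv.Perm.coe_mul, Function.comp_assoc]
  congr 1

lemma psi_one (d n : ℕ) : psi d n 1 = 1 := by
  ext x y
  simp [psi, Matrix.one_apply, eq_comm]

lemma psi_conjTranspose (d n : ℕ) (π : Equiv.Perm (Fin n)) :
    (psi d n π)ᴴ = psi d n π⁻¹ := by
  ext x y
  have h : (x = y ∘ π) ↔ (y = x ∘ ⇑π⁻¹) := by
    constructor
    · rintro rfl
      funext i; simp
    · rintro rfl
      funext i; simp
  simp only [psi, Matrix.conjTranspose_apply, Matrix.of_apply, h]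
  split_ifs <;> simp

lemma symm_mul_psi (d n : ℕ) (π : Equiv.Perm (Fin n)) :
    symmetrizer d n * psi d n π = symmetrizer d n := by
  rw [symmetrizer, Matrix.smul_mul, Finset.sum_mul]
  simp_rw [psi_mul_psi]
  congr 1
  exact Fintype.sum_equiv (Equiv.mulRight π) _ _ (fun σ => rfl)

lemma psi_mul_symm (d n : ℕ) (π : Equiv.Perm (Fin n)) :
    psi d n π * symmetrizer d n = symmetrizer d n := by
  rw [symmetrizer, Matrix.mul_smul, Finset.mul_sum]
  simp_rw [psi_mul_psi]
  congr 1
  exact Fintype.sum_equiv (Equiv.mulLeft π) _ _ (fun σ => rfl)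

lemma fact_ne (n : ℕ) : (n.factorial : ℂ) ≠ 0 := by
  exact_mod_cast n.factorial_ne_zero

lemma avg_const (n : ℕ) {M : Type*} [AddCommGroup M] [Module ℂ M] (A : M) :
    ((n.factorial : ℂ))⁻¹ • ∑ _π : Equiv.Perm (Fin n), A = A := by
  rw [Finset.sum_const, Finset.card_univ, Fintype.card_perm, Fintype.card_fin,
    ← Nat.cast_smul_eq_nsmul ℂ, smul_smul, inv_mul_cancel₀ (fact_ne n), one_smul]

lemma mul_symm_of (d n : ℕ) (A : Matrix (Fin n → Fin d) (Fin n → Fin d) ℂ)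
    (h : ∀ π, A * psi d n π = A) : A * symmetrizer d n = A := by
  rw [symmetrizer, Matrix.mul_smul, Finset.mul_sum]
  simp_rw [h]
  exact avg_const n A

lemma symm_mul_of (d n : ℕ) (A : Matrix (Fin n → Fin d) (Fin n → Fin d) ℂ)
    (h : ∀ π, psi d n π * A = A) : symmetrizer d n * A = A := by
  rw [symmetrizer, Matrix.smul_mul, Finset.sum_mul]
  simp_rw [h]
  exact avg_const n A

lemma symm_sq (d n : ℕ) : symmetrizer d n * symmetrizer d n = symmetrizer d n :=
  mul_symm_of d n _ (symm_mul_psi d n)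

lemma symm_herm (d n : ℕ) : (symmetrizer d n)ᴴ = symmetrizer d n := by
  rw [symmetrizer, Matrix.conjTranspose_smul, Matrix.conjTranspose_sum]
  simp_rw [psi_conjTranspose]
  congr 1
  · simp
  · exact Fintype.sum_equiv (Equiv.inv _) _ _ (fun σ => rfl)

lemma symm_posSemidef (d n : ℕ) : (symmetrizer d n).PosSemidef := by
  have h := Matrix.posSemidef_conjTranspose_mul_self (symmetrizer d n)
  rwa [symm_herm, symm_sq] at h

lemma compl_herm (d n : ℕ) : (1 - symmetrizer d n)ᴴ = 1 - symmetrizer d n := by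
  rw [Matrix.conjTranspose_sub, symm_herm, Matrix.conjTranspose_one]

lemma compl_sq (d n : ℕ) :
    (1 - symmetrizer d n) * (1 - symmetrizer d n) = 1 - symmetrizer d n := by
  rw [sub_mul, mul_sub, mul_sub, symm_sq]; simp

lemma compl_posSemidef (d n : ℕ) : (1 - symmetrizer d n).PosSemidef := by
  have h := Matrix.posSemidef_conjTranspose_mul_self (1 - symmetrizer d n)
  rwa [compl_herm, compl_sq] at h

lemma tpow_mul (d n : ℕ) (U V : Matrix (Fin d) (Fin d) ℂ) :
    tpow d n (U * V) = tpow d n U * tpow d n V := by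
  ext x y
  simp only [tpow, Matrix.of_apply, Matrix.mul_apply]
  rw [Finset.prod_univ_sum, Fintype.piFinset_univ]
  simp_rw [Finset.prod_mul_distrib]

lemma tpow_one (d n : ℕ) : tpow d n 1 = 1 := by
  ext x y
  simp only [tpow, Matrix.of_apply, Matrix.one_apply, Finset.prod_ite_zero, funext_iff]
  simp

lemma tpow_star (d n : ℕ) (U : Matrix (Fin d) (Fin d) ℂ) :
    tpow d n (star U) = (tpow d n U)ᴴ := by
  ext x y
  simp [tpow, Matrix.star_apply]

lemma tpow_unit (d n : ℕ) (U : UG d) :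
    (tpow d n (U : Matrix (Fin d) (Fin d) ℂ))ᴴ * tpow d n (U : Matrix (Fin d) (Fin d) ℂ) = 1 := by
  rw [← tpow_star, ← tpow_mul, Unitary.coe_star_mul_self, tpow_one]

lemma psi_tpow (d n : ℕ) (U : Matrix (Fin d) (Fin d) ℂ) (π : Equiv.Perm (Fin n)) :
    psi d n π * tpow d n U = tpow d n U * psi d n π := by
  ext x y
  obtain ⟨z, rfl⟩ : ∃ z : Fin n → Fin d, y = z ∘ π := ⟨y ∘ ⇑π⁻¹, by funext i; simp⟩
  rw [psi_mul_apply, mul_psi_apply]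
  simp only [tpow, Matrix.of_apply, Function.comp]
  exact Equiv.prod_comp π (fun i => U (x i) (z i))

lemma symm_tpow (d n : ℕ) (U : Matrix (Fin d) (Fin d) ℂ) :
    symmetrizer d n * tpow d n U = tpow d n U * symmetrizer d n := by
  rw [symmetrizer, Matrix.smul_mul, Matrix.mul_smul, Finset.sum_mul, Finset.mul_sum]
  simp_rw [psi_tpow]

/-- Words with equal fibre sizes are related by a permutation. -/
lemma exists_perm (d n : ℕ) (x y : Fin n → Fin d)
    (h : ∀ k, Fintype.card {a // x a = k} = Fintype.card {a // y a = k}) :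
    ∃ π : Equiv.Perm (Fin n), y = x ∘ π := by
  let e : ∀ k, {a // y a = k} ≃ {a // x a = k} := fun k => Fintype.equivOfCardEq (h k).symm
  refine ⟨Equiv.ofFiberEquiv e, ?_⟩
  funext a
  exact (Equiv.ofFiberEquiv_map e a).symm

/-- A diagonal unitary with one entry `z` and ones elsewhere. -/
lemma diag_unitary (d : ℕ) (k : Fin d) (z : ℂ) (hz : z * star z = 1) :
    Matrix.diagonal (fun i => if i = k then z else 1) ∈ Matrix.unitaryGroup (Fin d) ℂ := by
  rw [Matrix.mem_unitaryGroup_iff, Matrix.star_eq_conjTranspose, Matrix.diagonal_conjTranspose,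
    Matrix.diagonal_mul_diagonal, ← Matrix.diagonal_one]
  congr 1
  funext i
  by_cases h : i = k
  · simpa [h] using hz
  · simp [h]

lemma tpow_diag (d n : ℕ) (k : Fin d) (z : ℂ) :
    tpow d n (Matrix.diagonal (fun i => if i = k then z else 1)) =
      Matrix.diagonal (fun x => z ^ Fintype.card {a // x a = k}) := by
  ext x y
  simp only [tpow, Matrix.of_apply, Matrix.diagonal_apply, Finset.prod_ite_zero]
  by_cases h : x = y
  · subst h
    simp [Finset.prod_ite, Fintype.card_subtype]
  · rw [if_neg h, if_neg]
    intro h'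
    exact h (funext fun i => h' i (Finset.mem_univ i))

/-- A unitary all of whose entries are nonzero. -/
lemma full_unitary (d : ℕ) (hd : 2 ≤ d) : ∃ U : UG d, ∀ i j,
    (U : Matrix (Fin d) (Fin d) ℂ) i j ≠ 0 := by
  have hdc : (d : ℂ) ≠ 0 := by
    have : d ≠ 0 := by omega
    exact_mod_cast this
  let J : Matrix (Fin d) (Fin d) ℂ := Matrix.of fun _ _ => (d : ℂ)⁻¹
  have hJ : J * J = J := by
    ext i j
    simp [J, Matrix.mul_apply, hdc]
  have hJs : star J = J := by
    ext i j
    simp [J, Matrix.star_apply]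
  have hu : (1 - (1 - Complex.I) • J) ∈ Matrix.unitaryGroup (Fin d) ℂ := by
    rw [Matrix.mem_unitaryGroup_iff, star_sub, star_smul, hJs, star_one, sub_mul, mul_sub, mul_sub,
      smul_mul_smul_comm, hJ]
    simp only [mul_one, one_mul]
    rw [sub_sub, ← add_sub_assoc, ← add_smul, ← sub_smul]
    have : star (1 - Complex.I) + (1 - Complex.I) - (1 - Complex.I) * star (1 - Complex.I) = 0 := by
      apply Complex.ext <;> simp
    rw [this]; simp
  refine ⟨⟨_, hu⟩, fun i j h => ?_⟩
  have him := congrArg Complex.im h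
  have h1 : ((1 : Matrix (Fin d) (Fin d) ℂ) i j).im = 0 := by
    rw [Matrix.one_apply]; split_ifs <;> simp
  have hdi : ((d : ℂ)⁻¹) = (((d : ℝ)⁻¹ : ℝ) : ℂ) := by push_cast; rfl
  simp only [Matrix.sub_apply, Matrix.smul_apply, J, Matrix.of_apply, smul_eq_mul, hdi,
    Complex.sub_im, Complex.im_mul_ofReal, h1] at him
  simp at him
  omega

lemma schur_zero (d n : ℕ) (hd : 2 ≤ d) (B : Matrix (Fin n → Fin d) (Fin n → Fin d) ℂ)
    (hB : ∀ π, B * psi d n π = B)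
    (hc : ∀ U : UG d, tpow d n (U : Matrix (Fin d) (Fin d) ℂ) * B = B * tpow d n U)
    (h0 : B (fun _ => ⟨0, by omega⟩) (fun _ => ⟨0, by omega⟩) = 0) : B = 0 := by
  have hperm : ∀ x y (π : Equiv.Perm (Fin n)), B x (y ∘ π) = B x y := fun x y π => by
    rw [← mul_psi_apply d n π B x y, hB]
  have hoff : ∀ x y, (¬ ∃ π : Equiv.Perm (Fin n), y = x ∘ π) → B x y = 0 := by
    intro x y hxy
    have : ∃ k, Fintype.card {a // x a = k} ≠ Fintype.card {a // y a = k} := by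
      by_contra! hcon
      exact hxy (exists_perm d n x y hcon)
    obtain ⟨k, hk⟩ := this
    have hz := Complex.isPrimitiveRoot_exp (n + 1) (by omega)
    set z := Complex.exp (2 * Real.pi * Complex.I / (n + 1 : ℕ)) with hzdef
    have hnz : z * star z = 1 := by
      have := Complex.mul_conj z
      rw [Complex.normSq_eq_norm_sq, hz.norm'_eq_one (by omega)] at this
      simpa using this
    have h1 := hc ⟨_, diag_unitary d k z hnz⟩
    simp only [tpow_diag] at h1
    have h2 := congrFun (congrFun h1 x) y
    rw [Matrix.diagonal_mul, Matrix.mul_diagonal] at h2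
    by_contra hne
    rw [mul_comm] at h2
    have h3 := mul_left_cancel₀ hne h2
    refine hk (hz.pow_inj ?_ ?_ h3)
    · have := Fintype.card_subtype_le (fun a => x a = k)
      simp only [Fintype.card_fin] at this; omega
    · have := Fintype.card_subtype_le (fun a => y a = k)
      simp only [Fintype.card_fin] at this; omega
  have hcol : ∀ x, B x (fun _ => ⟨0, by omega⟩) = 0 := by
    intro x
    by_cases h : ∃ π : Equiv.Perm (Fin n), (fun _ => ⟨0, by omega⟩ : Fin n → Fin d) = x ∘ π
    · obtain ⟨π, hπ⟩ := h
      have : x = fun _ => ⟨0, by omega⟩ := by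
        funext i
        have := congrFun hπ (π⁻¹ i)
        simpa using this.symm
      rw [this]; exact h0
    · exact hoff _ _ h
  obtain ⟨U, hU⟩ := full_unitary d hd
  have hdiag : ∀ x, B x x = 0 := by
    classical
    intro x
    have h1 := congrFun (congrFun (hc U) x) (fun _ => ⟨0, by omega⟩)
    rw [Matrix.mul_apply, Matrix.mul_apply] at h1
    simp only [hcol, mul_zero, Finset.sum_const_zero] at h1
    set w : Fin n → Fin d := fun _ => ⟨0, by omega⟩ with hw
    have h2 : ∀ y, B x y * tpow d n (U : Matrix (Fin d) (Fin d) ℂ) y w =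
        if ∃ π : Equiv.Perm (Fin n), y = x ∘ π then
          B x x * tpow d n (U : Matrix (Fin d) (Fin d) ℂ) x w else 0 := by
      intro y
      split_ifs with h
      · obtain ⟨π, rfl⟩ := h
        rw [hperm]
        congr 1
        simp only [tpow, Matrix.of_apply, hw, Function.comp]
        exact Equiv.prod_comp π (fun i => (U : Matrix (Fin d) (Fin d) ℂ) (x i) ⟨0, by omega⟩)
      · rw [hoff x y h, zero_mul]
    rw [Finset.sum_congr rfl fun y _ => h2 y] at h1
    rw [← Finset.sum_filter, Finset.sum_const, eq_comm, nsmul_eq_mul, mul_eq_zero,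
      mul_eq_zero] at h1
    rcases h1 with h1 | h1 | h1
    · exfalso
      have h3 := Finset.card_eq_zero.mp (Nat.cast_eq_zero.mp h1)
      have h4 : x ∈ Finset.univ.filter
          (fun y => ∃ π : Equiv.Perm (Fin n), y = x ∘ π) := by
        simp only [Finset.mem_filter, Finset.mem_univ, true_and]
        exact ⟨1, by simp⟩
      rw [h3] at h4
      simp at h4
    · exact h1
    · exfalso
      simp only [tpow, Matrix.of_apply] at h1
      exact (Finset.prod_ne_zero_iff.mpr fun i _ => hU _ _) h1
  ext x y
  by_cases h : ∃ π : Equiv.Perm (Fin n), y = x ∘ π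
  · obtain ⟨π, rfl⟩ := h
    rw [hperm, hdiag]; rfl
  · rw [hoff x y h]; rfl

lemma symm_apply (d n : ℕ) (w : Fin n → Fin d) :
    symmetrizer d n w w =
      (n.factorial : ℂ)⁻¹ * ((∏ i, (Fintype.card {a // w a = i}).factorial : ℕ) : ℂ) := by
  rw [← DomMulAct.stabilizer_card w]
  simp only [symmetrizer, Matrix.smul_apply, Matrix.sum_apply, psi, Matrix.of_apply, smul_eq_mul]
  rw [Finset.sum_boole, Fintype.card_subtype]
  have : ∀ π : Equiv.Perm (Fin n), (w = w ∘ π) ↔ (w ∘ π = w) := fun _ => eq_comm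
  simp only [this]

lemma schur (d n : ℕ) (hd : 2 ≤ d) (A : Matrix (Fin n → Fin d) (Fin n → Fin d) ℂ)
    (hA : ∀ π, A * psi d n π = A)
    (hc : ∀ U : UG d, tpow d n (U : Matrix (Fin d) (Fin d) ℂ) * A = A * tpow d n U) :
    ∃ a : ℂ, A = a • symmetrizer d n := by
  set w : Fin n → Fin d := fun _ => ⟨0, by omega⟩ with hw
  have hone : symmetrizer d n w w = 1 := by
    simp only [symmetrizer, Matrix.smul_apply, Matrix.sum_apply, psi, Matrix.of_apply]
    have : ∀ π : Equiv.Perm (Fin n), w = w ∘ π := fun π => rfl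
    simp only [← this, if_true]
    exact avg_const n (1 : ℂ)
  refine ⟨A w w, ?_⟩
  rw [← sub_eq_zero]
  refine schur_zero d n hd _ ?_ ?_ ?_
  · intro π
    rw [sub_mul, hA, Matrix.smul_mul, symm_mul_psi]
  · intro U
    rw [sub_mul, mul_sub, hc, Matrix.smul_mul, Matrix.mul_smul, symm_tpow]
  · rw [Matrix.sub_apply, Matrix.smul_apply, ← hw, hone]; simp

/-! Integration -/

lemma tpow_cont (d n : ℕ) (x w : Fin n → Fin d) :
    Continuous (fun U : UG d => tpow d n (U : Matrix (Fin d) (Fin d) ℂ) x w) := by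
  simp only [tpow, Matrix.of_apply]
  refine continuous_finsetProd _ fun i _ => ?_
  exact (continuous_subtype_val).matrix_elem _ _

lemma tpow_bound (d n : ℕ) (x w : Fin n → Fin d) (U : UG d) :
    ‖tpow d n (U : Matrix (Fin d) (Fin d) ℂ) x w‖ ≤ 1 := by
  simp only [tpow, Matrix.of_apply, norm_prod]
  exact Finset.prod_le_one (fun _ _ => norm_nonneg _)
    fun i _ => entry_norm_bound_of_unitary U.2 _ _

lemma tpow_int (d n : ℕ) (x y w : Fin n → Fin d) (q : Measure (UG d)) [IsProbabilityMeasure q] :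
    Integrable (fun U : UG d => tpow d n (U : Matrix (Fin d) (Fin d) ℂ) x w *
      star (tpow d n (U : Matrix (Fin d) (Fin d) ℂ) y w)) q := by
  refine Integrable.of_bound
    ((tpow_cont d n x w).mul (tpow_cont d n y w).star).aestronglyMeasurable 1 ?_
  refine Filter.Eventually.of_forall fun U => ?_
  rw [norm_mul, norm_star]
  exact mul_le_one₀ (tpow_bound d n x w U) (norm_nonneg _) (tpow_bound d n y w U)

/-- `Tr[B ρ_w]` as an integral. -/
lemma trace_rho (d n : ℕ) (w : Fin n → Fin d) (q : Measure (UG d)) [IsProbabilityMeasure q]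
    (B : Matrix (Fin n → Fin d) (Fin n → Fin d) ℂ) :
    Matrix.trace (B * rhoWord d n w q) =
      ∫ U : UG d, ((tpow d n (U : Matrix (Fin d) (Fin d) ℂ))ᴴ * B * tpow d n U) w w ∂q := by
  have h : ∀ U : UG d, ((tpow d n (U : Matrix (Fin d) (Fin d) ℂ))ᴴ * B * tpow d n U) w w =
      ∑ x, ∑ y, B x y * (tpow d n (U : Matrix (Fin d) (Fin d) ℂ) y w *
      star (tpow d n (U : Matrix (Fin d) (Fin d) ℂ) x w)) := by
    intro U
    rw [Matrix.mul_assoc, Matrix.mul_apply]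
    simp only [Matrix.mul_apply, Finset.mul_sum, Matrix.conjTranspose_apply]
    refine Finset.sum_congr rfl fun x _ => Finset.sum_congr rfl fun y _ => ?_
    ring
  simp only [h]
  rw [integral_finsetSum]
  swap
  · exact fun x _ => integrable_finsetSum _ fun y _ => (tpow_int d n y x w q).const_mul _
  simp only [Matrix.trace, Matrix.diag, Matrix.mul_apply]
  refine Finset.sum_congr rfl fun x _ => ?_
  rw [integral_finsetSum]
  swap
  · exact fun y _ => (tpow_int d n y x w q).const_mul _
  refine Finset.sum_congr rfl fun y _ => ?_
  rw [integral_const_mul]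
  rfl

lemma trace_rho_nonneg (d n : ℕ) (w : Fin n → Fin d) (q : Measure (UG d)) [IsProbabilityMeasure q]
    (B : Matrix (Fin n → Fin d) (Fin n → Fin d) ℂ) (hB : B.PosSemidef) :
    0 ≤ Matrix.trace (B * rhoWord d n w q) := by
  rw [trace_rho]
  exact integral_nonneg fun U => (hB.conjTranspose_mul_mul_same _).diag_nonneg

lemma trace_rho_comm (d n : ℕ) (w : Fin n → Fin d) (q : Measure (UG d)) [IsProbabilityMeasure q]
    (B : Matrix (Fin n → Fin d) (Fin n → Fin d) ℂ)
    (hB : ∀ U : UG d, B * tpow d n (U : Matrix (Fin d) (Fin d) ℂ) = tpow d n U * B) :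
    Matrix.trace (B * rhoWord d n w q) = B w w := by
  rw [trace_rho]
  have : ∀ U : UG d, ((tpow d n (U : Matrix (Fin d) (Fin d) ℂ))ᴴ * B * tpow d n U) = B := by
    intro U
    rw [Matrix.mul_assoc, hB, ← Matrix.mul_assoc, tpow_unit, Matrix.one_mul]
  simp only [this]
  simp

lemma rho_conj (d n : ℕ) (w : Fin n → Fin d) (q : Measure (UG d)) [IsProbabilityMeasure q]
    (hinv : ∀ V : UG d, Measure.map (fun U => V * U) q = q) (V : UG d) :
    tpow d n (V : Matrix (Fin d) (Fin d) ℂ) * rhoWord d n w q * (tpow d n V)ᴴ =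
      rhoWord d n w q := by
  ext x y
  have hV : Continuous (fun U : UG d => V * U) := continuous_const.mul continuous_id
  conv_rhs => rw [rhoWord, Matrix.of_apply, ← hinv V]
  rw [integral_map hV.measurable.aemeasurable]
  swap
  · exact ((tpow_cont d n x w).mul (tpow_cont d n y w).star).aestronglyMeasurable
  have h : ∀ U : UG d, tpow d n ((V * U : UG d) : Matrix (Fin d) (Fin d) ℂ) x w *
      star (tpow d n ((V * U : UG d) : Matrix (Fin d) (Fin d) ℂ) y w) =
      ∑ b, ∑ a, (tpow d n (V : Matrix (Fin d) (Fin d) ℂ) x a *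
        star (tpow d n (V : Matrix (Fin d) (Fin d) ℂ) y b)) *
        (tpow d n (U : Matrix (Fin d) (Fin d) ℂ) a w *
        star (tpow d n (U : Matrix (Fin d) (Fin d) ℂ) b w)) := by
    intro U
    rw [Submonoid.coe_mul, tpow_mul, Matrix.mul_apply, Matrix.mul_apply, star_sum,
      Finset.sum_mul_sum, Finset.sum_comm]
    refine Finset.sum_congr rfl fun b _ => Finset.sum_congr rfl fun a _ => ?_
    rw [star_mul']
    ring
  simp only [h]
  rw [integral_finsetSum]
  swap
  · exact fun b _ => integrable_finsetSum _ fun a _ => (tpow_int d n a b w q).const_mul _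
  rw [Matrix.mul_apply]
  refine Finset.sum_congr rfl fun b _ => ?_
  rw [integral_finsetSum, Matrix.mul_apply, Finset.sum_mul]
  swap
  · exact fun a _ => (tpow_int d n a b w q).const_mul _
  refine Finset.sum_congr rfl fun a _ => ?_
  rw [integral_const_mul, Matrix.conjTranspose_apply, rhoWord, Matrix.of_apply]
  ring

lemma rho_comm (d n : ℕ) (w : Fin n → Fin d) (q : Measure (UG d)) [IsProbabilityMeasure q]
    (hinv : ∀ V : UG d, Measure.map (fun U => V * U) q = q) (V : UG d) :
    tpow d n (V : Matrix (Fin d) (Fin d) ℂ) * rhoWord d n w q =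
      rhoWord d n w q * tpow d n V := by
  conv_rhs => rw [← rho_conj d n w q hinv V]
  rw [Matrix.mul_assoc _ (tpow d n (V : Matrix (Fin d) (Fin d) ℂ))ᴴ, tpow_unit, Matrix.mul_one]

/-- The symmetric block of `ρ_w` is a multiple of the symmetrizer. -/
lemma symm_block (d n : ℕ) (hd : 2 ≤ d) (w : Fin n → Fin d) (q : Measure (UG d))
    [IsProbabilityMeasure q]
    (hinv : ∀ V : UG d, Measure.map (fun U => V * U) q = q) :
    ∃ a : ℂ, symmetrizer d n * rhoWord d n w q * symmetrizer d n = a • symmetrizer d n ∧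
      a * Matrix.trace (symmetrizer d n) = symmetrizer d n w w := by
  obtain ⟨a, ha⟩ := schur d n hd (symmetrizer d n * rhoWord d n w q * symmetrizer d n)
    (fun π => by rw [Matrix.mul_assoc, symm_mul_psi])
    (fun U => by
      rw [Matrix.mul_assoc _ (symmetrizer d n) (tpow d n _), symm_tpow, ← Matrix.mul_assoc,
        ← Matrix.mul_assoc, ← symm_tpow, Matrix.mul_assoc (symmetrizer d n) (tpow d n _),
        rho_comm d n w q hinv]
      simp only [Matrix.mul_assoc, symm_tpow])
  refine ⟨a, ha, ?_⟩
  have h := congrArg Matrix.trace ha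
  rw [Matrix.trace_smul, Matrix.trace_mul_comm, ← Matrix.mul_assoc, symm_sq,
    trace_rho_comm d n w q _ (fun U => symm_tpow d n U)] at h
  exact h.symm

lemma word_card (d n : ℕ) (μ : Fin d → ℕ) (hsum : ∑ i, μ i = n) (k : Fin d) :
    Fintype.card {a // word d n μ hsum a = k} = μ k := by
  have hlen : (wordList d μ).length = n := by rw [wordList_length, hsum]
  have h1 : wordList d μ = List.ofFn (word d n μ hsum) := by
    apply List.ext_get
    · simp [hlen]
    · intro i h1 h2
      simp [word]
  have h2 : (wordList d μ).count k = μ k := by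
    simp [wordList, List.count_flatten, List.map_ofFn, List.sum_ofFn, List.count_replicate]
  rw [← h2, h1, Fintype.card_subtype, List.ofFn_eq_map, ← Multiset.coe_count,
    ← Multiset.map_coe, Multiset.count_map]
  simp only [eq_comm]
  rfl

lemma word_eq (d n : ℕ) (hd : 0 < d) :
    word d n (muEq d n hd) (muEq_sum d n hd) = fun _ => ⟨0, hd⟩ := by
  funext j
  have h : word d n (muEq d n hd) (muEq_sum d n hd) j ∈ wordList d (muEq d n hd) :=
    List.get_mem _ _
  rw [wordList, List.mem_flatten] at h
  obtain ⟨l, hl, hj⟩ := h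
  rw [List.mem_ofFn] at hl
  obtain ⟨i, rfl⟩ := hl
  rw [List.mem_replicate] at hj
  obtain ⟨h1, h2⟩ := hj
  rw [h2]
  by_contra hne
  simp [muEq, hne] at h1

lemma symm_word (d n : ℕ) (μ : Fin d → ℕ) (hsum : ∑ i, μ i = n) :
    symmetrizer d n (word d n μ hsum) (word d n μ hsum) =
      ((Nat.multinomial Finset.univ μ : ℝ)⁻¹ : ℝ) := by
  rw [symm_apply]
  simp only [word_card]
  have h := Nat.multinomial_spec Finset.univ μ
  rw [hsum] at h
  have hM : (Nat.multinomial Finset.univ μ : ℂ) ≠ 0 := by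
    exact_mod_cast (Nat.multinomial_pos _ _).ne'
  have hn := fact_ne n
  rw [← h] at hn ⊢
  rw [Nat.cast_mul] at hn ⊢
  have := left_ne_zero_of_mul hn
  push_cast at *
  field_simp

lemma rhoEQ_symm (d n : ℕ) (hd : 0 < d) (q : Measure (UG d)) :
    symmetrizer d n * rhoEQ d n hd q * symmetrizer d n = rhoEQ d n hd q := by
  have hinv : ∀ (x : Fin n → Fin d) (π : Equiv.Perm (Fin n)) (U : Matrix (Fin d) (Fin d) ℂ),
      tpow d n U (x ∘ π) (fun _ => ⟨0, hd⟩) = tpow d n U x (fun _ => ⟨0, hd⟩) := by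
    intro x π U
    simp only [tpow, Matrix.of_apply, Function.comp]
    exact Equiv.prod_comp π (fun i => U (x i) ⟨0, hd⟩)
  rw [symm_mul_of, mul_symm_of]
  · intro π
    ext x y
    obtain ⟨z, rfl⟩ : ∃ z : Fin n → Fin d, y = z ∘ π := ⟨y ∘ ⇑π⁻¹, by funext i; simp⟩
    rw [mul_psi_apply]
    simp only [rhoEQ, rhoNE, rhoWord, word_eq, Matrix.of_apply, hinv]
  · intro π
    ext x y
    rw [psi_mul_apply]
    simp only [rhoEQ, rhoNE, rhoWord, word_eq, Matrix.of_apply, hinv]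

lemma trace_twirl (d n : ℕ) (μ : Fin d → ℕ) (hsum : ∑ i, μ i = n) (q : Measure (UG d))
    (B : Matrix (Fin n → Fin d) (Fin n → Fin d) ℂ) :
    Matrix.trace (B * rhoTwirl d n μ hsum q) = ((n.factorial : ℂ))⁻¹ *
      ∑ π : Equiv.Perm (Fin n),
        Matrix.trace ((psi d n π)ᴴ * B * psi d n π * rhoNE d n μ hsum q) := by
  rw [rhoTwirl, Matrix.mul_smul, Matrix.trace_smul, Finset.mul_sum, Matrix.trace_sum, smul_eq_mul]
  congr 1
  refine Finset.sum_congr rfl fun π _ => ?_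
  rw [← Matrix.mul_assoc, Matrix.trace_mul_comm, psi_conjTranspose]
  simp only [Matrix.mul_assoc]

lemma symm_twirl (d n : ℕ) (μ : Fin d → ℕ) (hsum : ∑ i, μ i = n) (q : Measure (UG d)) :
    symmetrizer d n * rhoTwirl d n μ hsum q =
      symmetrizer d n * rhoNE d n μ hsum q * symmetrizer d n := by
  rw [rhoTwirl, Matrix.mul_smul, Finset.mul_sum]
  have : ∀ π : Equiv.Perm (Fin n), symmetrizer d n *
      (psi d n π * rhoNE d n μ hsum q * psi d n π⁻¹) =
      symmetrizer d n * rhoNE d n μ hsum q * psi d n π⁻¹ := fun π => by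
    rw [← Matrix.mul_assoc, ← Matrix.mul_assoc, symm_mul_psi]
  simp only [this]
  rw [← Finset.mul_sum, ← Matrix.mul_smul]
  congr 1
  rw [symmetrizer]
  congr 1
  exact Fintype.sum_equiv (Equiv.inv _) _ _ (fun σ => rfl)

lemma twirl_symm (d n : ℕ) (μ : Fin d → ℕ) (hsum : ∑ i, μ i = n) (q : Measure (UG d)) :
    rhoTwirl d n μ hsum q * symmetrizer d n =
      symmetrizer d n * rhoNE d n μ hsum q * symmetrizer d n := by
  rw [rhoTwirl, Matrix.smul_mul, Finset.sum_mul]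
  have : ∀ π : Equiv.Perm (Fin n),
      (psi d n π * rhoNE d n μ hsum q * psi d n π⁻¹) * symmetrizer d n =
      psi d n π * (rhoNE d n μ hsum q * symmetrizer d n) := fun π => by
    rw [Matrix.mul_assoc, psi_mul_symm, Matrix.mul_assoc]
  simp only [this]
  rw [← Finset.sum_mul, ← Matrix.smul_mul, Matrix.mul_assoc]
  rfl

lemma block_eq (d n : ℕ) (hd : 2 ≤ d) (hd0 : 0 < d) (μ : Fin d → ℕ) (hsum : ∑ i, μ i = n)
    (q : Measure (UG d)) [IsProbabilityMeasure q]
    (hinv : ∀ V : UG d, Measure.map (fun U => V * U) q = q) :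
    symmetrizer d n * rhoNE d n μ hsum q * symmetrizer d n =
      (((Nat.multinomial Finset.univ μ : ℝ)⁻¹ : ℝ) : ℂ) • rhoEQ d n hd0 q := by
  obtain ⟨a, ha, ha'⟩ := symm_block d n hd (word d n μ hsum) q hinv
  obtain ⟨b, hb, hb'⟩ := symm_block d n hd (word d n (muEq d n hd0) (muEq_sum d n hd0)) q hinv
  have hone : symmetrizer d n (word d n (muEq d n hd0) (muEq_sum d n hd0))
      (word d n (muEq d n hd0) (muEq_sum d n hd0)) = 1 := by
    rw [word_eq]
    simp only [symmetrizer, Matrix.smul_apply, Matrix.sum_apply, psi, Matrix.of_apply]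
    have : ∀ π : Equiv.Perm (Fin n), (fun _ => ⟨0, hd0⟩ : Fin n → Fin d) = (fun _ => ⟨0, hd0⟩) ∘ π :=
      fun π => rfl
    simp only [← this, if_true]
    exact avg_const n (1 : ℂ)
  rw [hone] at hb'
  rw [symm_word] at ha'
  have h1 := rhoEQ_symm d n hd0 q
  rw [rhoEQ, rhoNE] at h1
  rw [rhoEQ, rhoNE, rhoNE, ha, ← h1, hb, smul_smul]
  congr 1
  have ht : Matrix.trace (symmetrizer d n) ≠ 0 := right_ne_zero_of_mul (hb' ▸ one_ne_zero)
  apply mul_right_cancel₀ ht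
  rw [ha', mul_assoc, hb', mul_one]

lemma twirl_bound (d n : ℕ) (hd : 2 ≤ d) (hd0 : 0 < d) (μ : Fin d → ℕ) (hsum : ∑ i, μ i = n)
    (q : Measure (UG d)) [IsProbabilityMeasure q]
    (hinv : ∀ V : UG d, Measure.map (fun U => V * U) q = q)
    (P : Matrix (Fin n → Fin d) (Fin n → Fin d) ℂ) (hP : P.PosSemidef) :
    (Nat.multinomial Finset.univ μ : ℝ)⁻¹ * (Matrix.trace (P * rhoEQ d n hd0 q)).re ≤
      (Matrix.trace (P * rhoTwirl d n μ hsum q)).re := by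
  set S := symmetrizer d n with hS
  set R := rhoTwirl d n μ hsum q with hR
  have h1 := symm_twirl d n μ hsum q
  have h2 := twirl_symm d n μ hsum q
  rw [block_eq d n hd hd0 μ hsum q hinv] at h1 h2
  rw [← hS, ← hR] at h1 h2
  have h3 : S * R * S = S * R := by
    rw [h1, ← h2, Matrix.mul_assoc, symm_sq]
  have hdec : (1 - S) * R * (1 - S) = R - S * R := by
    rw [sub_mul, mul_sub, sub_mul, sub_mul, h3, one_mul, mul_one, mul_one, h2, h1]
    simp
  have hnn : 0 ≤ Matrix.trace ((1 - S) * P * (1 - S) * R) := by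
    rw [trace_twirl]
    refine mul_nonneg (by positivity) (Finset.sum_nonneg fun π _ => ?_)
    apply trace_rho_nonneg
    apply Matrix.PosSemidef.conjTranspose_mul_mul_same
    have := hP.conjTranspose_mul_mul_same (1 - S)
    rwa [compl_herm] at this
  have h4 : Matrix.trace ((1 - S) * P * (1 - S) * R) =
      Matrix.trace (P * R) - (((Nat.multinomial Finset.univ μ : ℝ)⁻¹ : ℝ) : ℂ) *
        Matrix.trace (P * rhoEQ d n hd0 q) := by
    rw [Matrix.mul_assoc, Matrix.mul_assoc, Matrix.trace_mul_comm, Matrix.mul_assoc, hdec, h1,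
      Matrix.mul_sub, Matrix.trace_sub, Matrix.mul_smul, Matrix.trace_smul, smul_eq_mul]
  rw [h4] at hnn
  have := (Complex.le_def.mp hnn).1
  rw [Complex.sub_re, Complex.re_ofReal_mul] at this
  simpa using this

end helpers

/-- Randomly permuting the inputs does not change the optimal success
probability: the same optimal values and optimal tests as for the ordered inputs. -/
theorem permutation_test_optimal_twirled (d n : ℕ) (hd : 2 ≤ d) (hn : 1 ≤ n)
    (μ : Fin d → ℕ) (hmono : ∀ i j : Fin d, i ≤ j → μ j ≤ μ i) (hsum : ∑ i, μ i = n)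
    (hμ2 : 1 ≤ μ ⟨1, by omega⟩)
    (p : ℝ) (hp0 : 0 ≤ p) (hp1 : p ≤ 1)
    (haar : Measure (UG d)) [IsProbabilityMeasure haar]
    (hinv : ∀ V : UG d, Measure.map (fun U => V * U) haar = haar) :
    (1 / (1 + (Nat.multinomial Finset.univ μ : ℝ)) ≤ p →
      sSup (successProbTwirl d n (by omega) μ hsum haar p '' POVMs d n)
          = 1 - (1 - p) / (Nat.multinomial Finset.univ μ : ℝ) ∧
      successProbTwirl d n (by omega) μ hsum haar p (symmetrizer d n)
          = 1 - (1 - p) / (Nat.multinomial Finset.univ μ : ℝ)) ∧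
    (p ≤ 1 / (1 + (Nat.multinomial Finset.univ μ : ℝ)) →
      sSup (successProbTwirl d n (by omega) μ hsum haar p '' POVMs d n) = 1 - p ∧
      successProbTwirl d n (by omega) μ hsum haar p 0 = 1 - p) := by
  have hd0 : 0 < d := by omega
  set M : ℝ := (Nat.multinomial Finset.univ μ : ℝ) with hM
  have hMpos : 0 < M := by
    rw [hM]; exact_mod_cast Nat.multinomial_pos _ _
  have htr1 : Matrix.trace (rhoEQ d n hd0 haar) = 1 := by
    have := trace_rho_comm d n (word d n (muEq d n hd0) (muEq_sum d n hd0)) haar 1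
      (fun U => by rw [Matrix.one_mul, Matrix.mul_one])
    rw [Matrix.one_mul, Matrix.one_apply_eq] at this
    exact this
  have hSEQ : symmetrizer d n * rhoEQ d n hd0 haar = rhoEQ d n hd0 haar := by
    rw [← rhoEQ_symm, ← Matrix.mul_assoc, ← Matrix.mul_assoc, symm_sq]
  have hSmem : symmetrizer d n ∈ POVMs d n := ⟨symm_posSemidef d n, compl_posSemidef d n⟩
  have h0mem : (0 : Matrix (Fin n → Fin d) (Fin n → Fin d) ℂ) ∈ POVMs d n :=
    ⟨Matrix.PosSemidef.zero, by rw [sub_zero]; exact Matrix.PosSemidef.one⟩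
  have hvalS : successProbTwirl d n hd0 μ hsum haar p (symmetrizer d n) = 1 - (1 - p) / M := by
    rw [successProbTwirl, hSEQ, htr1, symm_twirl, block_eq d n hd hd0 μ hsum haar hinv,
      Matrix.trace_smul, htr1, smul_eq_mul, mul_one, Complex.ofReal_re, Complex.one_re, ← hM]
    ring
  have hval0 : successProbTwirl d n hd0 μ hsum haar p 0 = 1 - p := by
    rw [successProbTwirl]; simp
  have hbd : ∀ P ∈ POVMs d n, ∃ t : ℝ, 0 ≤ t ∧ t ≤ 1 ∧
      successProbTwirl d n hd0 μ hsum haar p P ≤ (1 - p) + (p - (1 - p) * M⁻¹) * t := by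
    rintro P ⟨hP, hP'⟩
    refine ⟨(Matrix.trace (P * rhoEQ d n hd0 haar)).re, ?_, ?_, ?_⟩
    · exact (Complex.le_def.mp (trace_rho_nonneg d n _ haar P hP)).1
    · have h := (Complex.le_def.mp (trace_rho_nonneg d n
        (word d n (muEq d n hd0) (muEq_sum d n hd0)) haar _ hP')).1
      change (0 : ℂ).re ≤ (Matrix.trace ((1 - P) * rhoEQ d n hd0 haar)).re at h
      rw [Matrix.sub_mul, Matrix.one_mul, Matrix.trace_sub, htr1, Complex.sub_re] at h
      simp at h
      exact h
    · have h := twirl_bound d n hd hd0 μ hsum haar hinv P hP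
      rw [← hM] at h
      rw [successProbTwirl]
      have := mul_le_mul_of_nonneg_left h (sub_nonneg.mpr hp1)
      linarith
  refine ⟨fun hp => ⟨?_, hvalS⟩, fun hp => ⟨?_, hval0⟩⟩
  · refine IsGreatest.csSup_eq ⟨⟨_, hSmem, hvalS⟩, ?_⟩
    rintro _ ⟨P, hP, rfl⟩
    obtain ⟨t, ht0, ht1, hle⟩ := hbd P hP
    refine hle.trans ?_
    have hc : 0 ≤ p - (1 - p) * M⁻¹ := by
      rw [div_le_iff₀ (by positivity)] at hp
      rw [sub_nonneg, ← div_eq_mul_inv, div_le_iff₀ hMpos]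
      linarith
    have := mul_le_mul_of_nonneg_left ht1 hc
    rw [div_eq_mul_inv]
    linarith
  · refine IsGreatest.csSup_eq ⟨⟨_, h0mem, hval0⟩, ?_⟩
    rintro _ ⟨P, hP, rfl⟩
    obtain ⟨t, ht0, ht1, hle⟩ := hbd P hP
    refine hle.trans ?_
    have hc : p - (1 - p) * M⁻¹ ≤ 0 := by
      rw [le_div_iff₀ (by positivity)] at hp
      rw [sub_nonpos, ← div_eq_mul_inv, le_div_iff₀ hMpos]
      linarith
    have := mul_nonpos_of_nonpos_of_nonneg hc ht0
    linarith

end
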